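/- arXiv:1807.09575 — 5 statements merged into one kernel-verified Lean document; each statement's English description precedes it below -/
import Mathlib

section
/- Let A be an n×n real symmetric positive definite matrix and let λ ≥ 0. Then the matrix A⁻¹ − (A + λI)⁻¹ (A + 2λI) (A + λI)⁻¹ is positive semidefinite; equivalently, for every k ∈ ℝⁿ one has kᵀ (A + λI)⁻¹ (A + 2λI) (A + λI)⁻¹ k ≤ kᵀ A⁻¹ k. -/
open Matrix

/-- The gap between `A⁻¹` and the regularized expression is `c² (A + cI)⁻¹ A⁻¹ (A + cI)⁻¹`. -/
theorem Matrix.inv_sub_regularized {ι R : Type*} [Fintype ι] [DecidableEq ι] [CommRing R]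
    {A : Matrix ι ι R} {c : R} (hA : IsUnit A) (hB : IsUnit (A + c • (1 : Matrix ι ι R))) :
    A⁻¹ - (A + c • (1 : Matrix ι ι R))⁻¹ * (A + (2 * c) • (1 : Matrix ι ι R))
        * (A + c • (1 : Matrix ι ι R))⁻¹ =
      c ^ 2 • ((A + c • (1 : Matrix ι ι R))⁻¹ * A⁻¹ * (A + c • (1 : Matrix ι ι R))⁻¹) := by
  have hA' := (isUnit_iff_isUnit_det A).1 hA
  have hB' := (isUnit_iff_isUnit_det _).1 hB
  have key : (A + c • (1 : Matrix ι ι R)) * A⁻¹ * (A + c • (1 : Matrix ι ι R)) =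
      A + (2 * c) • (1 : Matrix ι ι R) + c ^ 2 • A⁻¹ := by
    simp only [add_mul, mul_add, smul_mul_assoc, mul_smul_comm, one_mul, mul_one,
      mul_nonsing_inv A hA', nonsing_inv_mul A hA']
    module
  set B := A + c • (1 : Matrix ι ι R)
  have hinv : A⁻¹ = B⁻¹ * (B * A⁻¹ * B) * B⁻¹ := by
    rw [mul_assoc B, nonsing_inv_mul_cancel_left _ _ hB', mul_nonsing_inv_cancel_right _ _ hB']
  rw [key, mul_add, add_mul, mul_smul_comm, smul_mul_assoc] at hinv
  exact sub_eq_iff_eq_add'.2 hinv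

/-- for `A` symmetric positive definite and `λ ≥ 0`, the matrix
`A⁻¹ − (A+λI)⁻¹(A+2λI)(A+λI)⁻¹` is positive semidefinite; equivalently,
`kᵀ(A+λI)⁻¹(A+2λI)(A+λI)⁻¹k ≤ kᵀA⁻¹k` for every `k`. This is exactly
`P_n(x) ≤ P_n^λ(x)` for the power functions. -/
theorem stmt_7 (n : ℕ) (A : Matrix (Fin n) (Fin n) ℝ) (hA : A.PosDef)
    (lam : ℝ) (hlam : 0 ≤ lam) :
    (A⁻¹ - (A + lam • (1 : Matrix (Fin n) (Fin n) ℝ))⁻¹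
        * (A + (2 * lam) • (1 : Matrix (Fin n) (Fin n) ℝ))
        * (A + lam • (1 : Matrix (Fin n) (Fin n) ℝ))⁻¹).PosSemidef ∧
    ∀ k : Fin n → ℝ,
      k ⬝ᵥ ((A + lam • (1 : Matrix (Fin n) (Fin n) ℝ))⁻¹
          * (A + (2 * lam) • (1 : Matrix (Fin n) (Fin n) ℝ))
          * (A + lam • (1 : Matrix (Fin n) (Fin n) ℝ))⁻¹) *ᵥ k
        ≤ k ⬝ᵥ A⁻¹ *ᵥ k := by
  have hB : (A + lam • (1 : Matrix (Fin n) (Fin n) ℝ)).PosDef :=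
    hA.add_posSemidef (PosSemidef.one.smul hlam)
  have hpsd : (A⁻¹ - (A + lam • (1 : Matrix (Fin n) (Fin n) ℝ))⁻¹
      * (A + (2 * lam) • (1 : Matrix (Fin n) (Fin n) ℝ))
      * (A + lam • (1 : Matrix (Fin n) (Fin n) ℝ))⁻¹).PosSemidef := by
    rw [Matrix.inv_sub_regularized hA.isUnit hB.isUnit]
    have h := hA.inv.posSemidef.conjTranspose_mul_mul_same
      (A + lam • (1 : Matrix (Fin n) (Fin n) ℝ))⁻¹
    rw [hB.inv.isHermitian.eq] at h
    exact h.smul (sq_nonneg lam)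
  refine ⟨hpsd, fun k => ?_⟩
  have h := hpsd.dotProduct_mulVec_nonneg k
  rwa [star_trivial, sub_mulVec, dotProduct_sub, sub_nonneg] at h
end

section
/- Let A be an n×n real symmetric positive definite matrix, let λ > 0 and 0 ≤ μ ≤ λ, and define B(μ, λ) := −(A + λI)⁻¹ + (A + μI)⁻¹ (A + 2μI) (A + μI)⁻¹ − λ (A + μI)⁻². Then B(μ, λ) is negative semidefinite, i.e., kᵀ B(μ, λ) k ≤ 0 for every k ∈ ℝⁿ; and if μ = λ then B(μ, λ) is the zero matrix. -/
open Matrix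

/-- The second-order resolvent expansion of `(M + d • 1)⁻¹` around `M⁻¹`. -/
theorem Matrix.neg_inv_add_smul_one_add_inv_sub {n R : Type*} [Fintype n] [DecidableEq n]
    [CommRing R] {M : Matrix n n R} {d : R} (hM : IsUnit M.det)
    (hL : IsUnit (M + d • (1 : Matrix n n R)).det) :
    -(M + d • (1 : Matrix n n R))⁻¹ + M⁻¹ - d • (M⁻¹ * M⁻¹)
      = -(d ^ 2 • (M⁻¹ * (M + d • (1 : Matrix n n R))⁻¹ * M⁻¹)) := by
  set Y := (M + d • (1 : Matrix n n R))⁻¹ with hY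
  have left_diff : M⁻¹ - Y = d • (M⁻¹ * Y) := by
    have h : M⁻¹ * ((M + d • (1 : Matrix n n R)) * Y) = M⁻¹ := by
      rw [hY, Matrix.mul_nonsing_inv _ hL, mul_one]
    rw [add_mul, mul_add, ← mul_assoc, Matrix.nonsing_inv_mul _ hM, one_mul, smul_mul_assoc,
      one_mul, mul_smul_comm] at h
    rw [sub_eq_iff_eq_add, add_comm]
    exact h.symm
  have right_diff : M⁻¹ - Y = d • (Y * M⁻¹) := by
    have h : Y * (M + d • (1 : Matrix n n R)) * M⁻¹ = M⁻¹ := by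
      rw [hY, Matrix.nonsing_inv_mul _ hL, one_mul]
    rw [mul_add, add_mul, mul_assoc, Matrix.mul_nonsing_inv _ hM, mul_one, mul_smul_comm,
      mul_one, smul_mul_assoc] at h
    rw [sub_eq_iff_eq_add, add_comm]
    exact h.symm
  have expand : d ^ 2 • (M⁻¹ * Y * M⁻¹) = d • (M⁻¹ * M⁻¹) - (M⁻¹ - Y) := by
    rw [pow_two, mul_smul, ← smul_mul_assoc d (M⁻¹ * Y), ← left_diff, sub_mul, smul_sub,
      ← right_diff]
  rw [expand]
  abel

/-- A nonnegative shift of a positive definite matrix is positive definite. -/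
theorem Matrix.PosDef.add_smul_one {n : Type*} [Fintype n] [DecidableEq n]
    {A : Matrix n n ℝ} (hA : A.PosDef) {t : ℝ} (ht : 0 ≤ t) :
    (A + t • (1 : Matrix n n ℝ)).PosDef :=
  hA.add_posSemidef (Matrix.PosSemidef.one.smul ht)

/-- for `A` symmetric positive definite, `λ > 0` and
`0 ≤ μ ≤ λ`, the matrix
`B(μ,λ) = −(A+λI)⁻¹ + (A+μI)⁻¹(A+2μI)(A+μI)⁻¹ − λ(A+μI)⁻²`
is negative semidefinite, and it is the zero matrix when `μ = λ`. This is
exactly `Q_n^λ(x)² ≤ P_n^μ(x)² + λ(1 + Λ_{n,2}^μ(x)²)`, with equality for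
`μ = λ`. -/
theorem stmt_10 (n : ℕ) (A : Matrix (Fin n) (Fin n) ℝ) (hA : A.PosDef)
    (lam mu : ℝ) (hlam : 0 < lam) (hmu : 0 ≤ mu) (hml : mu ≤ lam)
    (B : Matrix (Fin n) (Fin n) ℝ)
    (hB : B = -(A + lam • (1 : Matrix (Fin n) (Fin n) ℝ))⁻¹
        + (A + mu • (1 : Matrix (Fin n) (Fin n) ℝ))⁻¹
          * (A + (2 * mu) • (1 : Matrix (Fin n) (Fin n) ℝ))
          * (A + mu • (1 : Matrix (Fin n) (Fin n) ℝ))⁻¹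
        - lam • ((A + mu • (1 : Matrix (Fin n) (Fin n) ℝ))⁻¹) ^ 2) :
    (∀ k : Fin n → ℝ, k ⬝ᵥ B *ᵥ k ≤ 0) ∧ (mu = lam → B = 0) := by
  have hM := hA.add_smul_one hmu
  have hL := hA.add_smul_one hlam.le
  set M := A + mu • (1 : Matrix (Fin n) (Fin n) ℝ) with hMdef
  have hLM : A + lam • (1 : Matrix (Fin n) (Fin n) ℝ) = M + (lam - mu) • 1 := by
    rw [hMdef]; module
  have hAM : A + (2 * mu) • (1 : Matrix (Fin n) (Fin n) ℝ) = M + mu • 1 := by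
    rw [hMdef]; module
  have hMdet : IsUnit M.det := hM.det_pos.ne'.isUnit
  rw [hLM] at hL
  have hBeq : B = -((lam - mu) ^ 2 • (M⁻¹ * (M + (lam - mu) • 1)⁻¹ * M⁻¹)) := by
    rw [← Matrix.neg_inv_add_smul_one_add_inv_sub hMdet hL.det_pos.ne'.isUnit, hB, hLM, hAM,
      mul_add, Matrix.nonsing_inv_mul _ hMdet, add_mul, one_mul, mul_smul_comm, mul_one,
      smul_mul_assoc, pow_two]
    module
  refine ⟨fun k => ?_, fun h => by simp [hBeq, h]⟩
  have hsemi : (M⁻¹ * (M + (lam - mu) • 1)⁻¹ * M⁻¹).PosSemidef := by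
    have h := hL.inv.posSemidef.mul_mul_conjTranspose_same M⁻¹
    rwa [hM.inv.isHermitian.eq] at h
  have hk := (hsemi.smul (sq_nonneg (lam - mu))).dotProduct_mulVec_nonneg k
  rw [star_trivial] at hk
  rw [hBeq, Matrix.neg_mulVec, dotProduct_neg]
  exact neg_nonpos.mpr hk
end

section
/- Let σ, d : ℕ → ℝ be sequences with σ_n ≥ 0 and d_n ≥ 0 for all n, σ nonincreasing, and suppose that for all integers N ≥ 0, K ≥ 1 and 1 ≤ m < K one has ∏_{i=1}^{K} σ_{N+i}² ≤ (K/m)^m (K/(K−m))^{K−m} σ_{N+1}^{2m} d_m^{2(K−m)}. Then for every integer s ≥ 1, σ_{4s} ≤ √2 · √(σ_{2s} · d_s). -/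
/-- from the DeVore–Petrova–Wojtaszczyk product inequality for
the greedy errors `σ` and Kolmogorov widths `d`, one deduces
`σ_{4s} ≤ √2 √(σ_{2s} d_s)` for every `s ≥ 1`. -/
theorem stmt_13 (σ d : ℕ → ℝ) (hσ0 : ∀ n, 0 ≤ σ n) (hd0 : ∀ n, 0 ≤ d n)
    (hmono : ∀ m n : ℕ, m ≤ n → σ n ≤ σ m)
    (hDPW : ∀ (N K m : ℕ), 1 ≤ K → 1 ≤ m → m < K →
      ∏ i ∈ Finset.Icc 1 K, σ (N + i) ^ 2
        ≤ ((K : ℝ) / m) ^ m * ((K : ℝ) / ((K : ℝ) - m)) ^ (K - m)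
            * σ (N + 1) ^ (2 * m) * d m ^ (2 * (K - m))) :
    ∀ s : ℕ, 1 ≤ s →
      σ (4 * s) ≤ Real.sqrt 2 * Real.sqrt (σ (2 * s) * d s) := by
  intro s hs
  have hs0 : (s : ℝ) ≠ 0 := by positivity
  have hK := hDPW (2 * s) (2 * s) s (by omega) hs (by omega)
  have hsub : 2 * s - s = s := by omega
  have h1 : ((2 * s : ℕ) : ℝ) / s = 2 := by
    push_cast
    field_simp
  have h2 : ((2 * s : ℕ) : ℝ) / (((2 * s : ℕ) : ℝ) - s) = 2 := by
    push_cast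
    rw [show (2 : ℝ) * s - s = s by ring]
    field_simp
  rw [hsub, h1, h2] at hK
  have hprod : (σ (4 * s) ^ 2) ^ (2 * s) ≤ ∏ i ∈ Finset.Icc 1 (2 * s), σ (2 * s + i) ^ 2 := by
    calc (σ (4 * s) ^ 2) ^ (2 * s)
        = ∏ _i ∈ Finset.Icc 1 (2 * s), σ (4 * s) ^ 2 := by simp
      _ ≤ _ := by
        refine Finset.prod_le_prod (fun _ _ => sq_nonneg _) fun i hi => ?_
        have hi2 := (Finset.mem_Icc.mp hi).2
        exact pow_le_pow_left₀ (hσ0 _) (hmono _ _ (by omega)) 2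
  have hstep : σ (2 * s + 1) ^ (2 * s) ≤ σ (2 * s) ^ (2 * s) :=
    pow_le_pow_left₀ (hσ0 _) (hmono _ _ (by omega)) _
  have hpow : (σ (4 * s) ^ 2) ^ (2 * s) ≤ (2 * (σ (2 * s) * d s)) ^ (2 * s) := by
    calc (σ (4 * s) ^ 2) ^ (2 * s)
        ≤ (2 : ℝ) ^ s * 2 ^ s * σ (2 * s + 1) ^ (2 * s) * d s ^ (2 * s) := hprod.trans hK
      _ ≤ (2 : ℝ) ^ s * 2 ^ s * σ (2 * s) ^ (2 * s) * d s ^ (2 * s) := by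
        have := pow_nonneg (hd0 s) (2 * s)
        gcongr
      _ = (2 * (σ (2 * s) * d s)) ^ (2 * s) := by
        rw [mul_pow, mul_pow, ← pow_add, ← two_mul, mul_assoc]
  have hsq : σ (4 * s) ^ 2 ≤ 2 * (σ (2 * s) * d s) :=
    le_of_pow_le_pow_left₀ (by omega)
      (mul_nonneg zero_le_two (mul_nonneg (hσ0 _) (hd0 _))) hpow
  rw [← Real.sqrt_mul zero_le_two]
  exact Real.le_sqrt_of_sq_le hsq
end

section
/- Let σ, d : ℕ → ℝ be sequences with σ_n ≥ 0 and d_n ≥ 0 for all n, σ nonincreasing, and suppose that for all integers N ≥ 0, K ≥ 1 and 1 ≤ m < K one has ∏_{i=1}^{K} σ_{N+i}² ≤ (K/m)^m (K/(K−m))^{K−m} σ_{N+1}^{2m} d_m^{2(K−m)}. Then for all integers n ≥ 2 and 1 ≤ m < n, σ_n ≤ √2 · σ_0^{m/n} · d_m^{(n−m)/n}. -/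
/-- The `n`-th power of `x ^ (a / n)` is `x ^ a`. -/
lemma rpow_natCast_div_pow {x : ℝ} (hx : 0 ≤ x) (a : ℕ) {n : ℕ} (hn : n ≠ 0) :
    (x ^ ((a : ℝ) / n)) ^ n = x ^ a := by
  have hn' : (n : ℝ) ≠ 0 := Nat.cast_ne_zero.mpr hn
  rw [← Real.rpow_mul_natCast hx, div_mul_cancel₀ _ hn', Real.rpow_natCast]

/-- The binary entropy bound in product form, by the weighted AM-GM inequality. -/
lemma div_pow_mul_div_sub_pow_le_two_pow {m n : ℕ} (hm : 1 ≤ m) (hmn : m < n) :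
    ((n : ℝ) / m) ^ m * ((n : ℝ) / ((n : ℝ) - m)) ^ (n - m) ≤ 2 ^ n := by
  have hm0 : (0 : ℝ) < m := by exact_mod_cast hm
  have hsub : (0 : ℝ) < (n : ℝ) - m := sub_pos.mpr (by exact_mod_cast hmn)
  have hn0 : (0 : ℝ) < n := by linarith
  have hn : n ≠ 0 := by omega
  have hx : 0 ≤ (n : ℝ) / m := by positivity
  have hy : 0 ≤ (n : ℝ) / ((n : ℝ) - m) := by positivity
  have hcast : ((n - m : ℕ) : ℝ) = (n : ℝ) - m := Nat.cast_sub hmn.le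
  have amgm := Real.geom_mean_le_arith_mean2_weighted
    (w₁ := (m : ℝ) / n) (w₂ := ((n : ℝ) - m) / n) (by positivity) (by positivity) hx hy
    (by field_simp; ring)
  have htwo : (m : ℝ) / n * (n / m) + ((n : ℝ) - m) / n * (n / ((n : ℝ) - m)) = 2 := by
    field_simp
    norm_num
  rw [htwo, ← hcast] at amgm
  have hpow := pow_le_pow_left₀ (by positivity) amgm n
  rwa [mul_pow, rpow_natCast_div_pow hx _ hn, rpow_natCast_div_pow (by positivity) _ hn,
    hcast] at hpow


/-- from the DeVore–Petrova–Wojtaszczyk product inequality for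
the greedy errors `σ` and Kolmogorov widths `d`, one deduces
`σ_n ≤ √2 · σ_0^{m/n} · d_m^{(n−m)/n}` for all `2 ≤ n` and `1 ≤ m < n`. -/
theorem stmt_14 (σ d : ℕ → ℝ) (hσ0 : ∀ n, 0 ≤ σ n) (hd0 : ∀ n, 0 ≤ d n)
    (hmono : ∀ m n : ℕ, m ≤ n → σ n ≤ σ m)
    (hDPW : ∀ (N K m : ℕ), 1 ≤ K → 1 ≤ m → m < K →
      ∏ i ∈ Finset.Icc 1 K, σ (N + i) ^ 2
        ≤ ((K : ℝ) / m) ^ m * ((K : ℝ) / ((K : ℝ) - m)) ^ (K - m)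
            * σ (N + 1) ^ (2 * m) * d m ^ (2 * (K - m))) :
    ∀ n m : ℕ, 2 ≤ n → 1 ≤ m → m < n →
      σ n ≤ Real.sqrt 2 * σ 0 ^ ((m : ℝ) / (n : ℝ))
          * d m ^ (((n : ℝ) - (m : ℝ)) / (n : ℝ)) := by
  intro n m hn hm hmn
  have hn0 : n ≠ 0 := by omega
  have hσ := hσ0 0
  have hd := hd0 m
  have hcast : (n : ℝ) - m = ((n - m : ℕ) : ℝ) := (Nat.cast_sub hmn.le).symm
  refine le_of_pow_le_pow_left₀ (n := n * 2) (by omega) (by positivity) ?_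
  calc σ n ^ (n * 2) = ∏ _i ∈ Finset.Icc 1 n, σ n ^ 2 := by
        rw [Finset.prod_const, Nat.card_Icc, Nat.add_sub_cancel, ← pow_mul, mul_comm]
    _ ≤ ∏ i ∈ Finset.Icc 1 n, σ (0 + i) ^ 2 :=
        Finset.prod_le_prod (fun _ _ => sq_nonneg _) fun i hi =>
          pow_le_pow_left₀ (hσ0 n) (hmono _ _ (by simpa using (Finset.mem_Icc.mp hi).2)) 2
    _ ≤ ((n : ℝ) / m) ^ m * ((n : ℝ) / ((n : ℝ) - m)) ^ (n - m)
          * σ (0 + 1) ^ (2 * m) * d m ^ (2 * (n - m)) := hDPW 0 n m (by omega) hm hmn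
    _ ≤ 2 ^ n * σ 0 ^ (2 * m) * d m ^ (2 * (n - m)) := by
        have h1 := hσ0 (0 + 1)
        gcongr
        · exact div_pow_mul_div_sub_pow_le_two_pow hm hmn
        · exact hmono 0 (0 + 1) (by omega)
    _ = _ := by
        have hsqrt : (Real.sqrt 2 ^ n) ^ 2 = 2 ^ n := by
          rw [← pow_mul, mul_comm, pow_mul, Real.sq_sqrt (by norm_num)]
        rw [hcast, pow_mul _ n 2, mul_pow, mul_pow, mul_pow, mul_pow, rpow_natCast_div_pow hσ _ hn0,
          rpow_natCast_div_pow hd _ hn0, hsqrt, ← pow_mul, ← pow_mul,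
          mul_comm m 2, mul_comm (n - m) 2]
end

section
/- Let α > 0, η > 0, C₀ > 0, and let σ, d : ℕ → ℝ be sequences with σ_n ≥ 0 and d_n ≥ 0 for all n and σ nonincreasing. Set C₁ := 2^{1+5α} C₀. Assume: (a) σ_{4s} ≤ √2 · √(σ_{2s} · d_s) for every integer s ≥ 1; (b) d_n ≤ C₀ (n^{−α} + η) for every integer n ≥ 1; (c) σ_n ≤ C₁ (n^{−α} + η) for n ∈ {1, 2, 3}. Then σ_n ≤ C₁ (n^{−α} + η) for every integer n ≥ 1. -/
/-- If `n ≤ c * s`, then `s ^ (-α) + η` is at most `c ^ α` times `n ^ (-α) + η`. -/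
lemma rpow_neg_add_le_rpow_mul {α η c s n : ℝ} (hα : 0 ≤ α) (hη : 0 ≤ η) (hc : 1 ≤ c)
    (hs : 0 < s) (hn : 0 < n) (h : n ≤ c * s) :
    s ^ (-α) + η ≤ c ^ α * (n ^ (-α) + η) := by
  have hc0 : 0 < c := by linarith
  have hpow : (c * s) ^ (-α) ≤ n ^ (-α) :=
    Real.rpow_le_rpow_of_nonpos hn h (by linarith)
  have hsplit : s ^ (-α) = c ^ α * (c * s) ^ (-α) := by
    rw [Real.mul_rpow hc0.le hs.le, ← mul_assoc, ← Real.rpow_add hc0, add_neg_cancel,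
      Real.rpow_zero, one_mul]
  have hη' : η ≤ c ^ α * η := le_mul_of_one_le_left hη (Real.one_le_rpow hc hα)
  rw [mul_add, hsplit]
  gcongr

/-- algebraic-decay case of the generalized
DeVore–Petrova–Wojtaszczyk argument with widths converging to `η > 0`: if
`d_n ≤ C₀(n^{−α} + η)`, the key inequality `σ_{4s} ≤ √2 √(σ_{2s} d_s)` holds,
and the claimed bound holds for `n = 1, 2, 3`, then
`σ_n ≤ C₁(n^{−α} + η)` for all `n ≥ 1`, with `C₁ = 2^{1+5α} C₀`. -/
theorem stmt_15 (α η C₀ : ℝ) (hα : 0 < α) (hη : 0 < η) (hC₀ : 0 < C₀)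
    (σ d : ℕ → ℝ) (hσ0 : ∀ n, 0 ≤ σ n) (hd0 : ∀ n, 0 ≤ d n)
    (hmono : ∀ m n : ℕ, m ≤ n → σ n ≤ σ m)
    (C₁ : ℝ) (hC₁ : C₁ = (2 : ℝ) ^ (1 + 5 * α) * C₀)
    (ha : ∀ s : ℕ, 1 ≤ s →
      σ (4 * s) ≤ Real.sqrt 2 * Real.sqrt (σ (2 * s) * d s))
    (hb : ∀ n : ℕ, 1 ≤ n → d n ≤ C₀ * ((n : ℝ) ^ (-α) + η))
    (hc : ∀ n : ℕ, n = 1 ∨ n = 2 ∨ n = 3 → σ n ≤ C₁ * ((n : ℝ) ^ (-α) + η)) :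
    ∀ n : ℕ, 1 ≤ n → σ n ≤ C₁ * ((n : ℝ) ^ (-α) + η) := by
  have hC : C₁ = 2 * (4 ^ α * 8 ^ α) * C₀ := by
    rw [hC₁, Real.rpow_add two_pos, Real.rpow_one, Real.rpow_mul zero_le_two,
      ← Real.mul_rpow (by norm_num) (by norm_num)]
    norm_num
  have hC₁0 : 0 < C₁ := by rw [hC]; positivity
  intro n
  induction n using Nat.strong_induction_on with
  | _ n ih =>
    intro hn
    by_cases hn4 : n < 4
    · exact hc n (by omega)
    obtain ⟨s, hs, hsn, hns⟩ : ∃ s : ℕ, 1 ≤ s ∧ 4 * s ≤ n ∧ n ≤ 8 * s :=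
      ⟨n / 4, by omega, by omega, by omega⟩
    have hs0 : (0 : ℝ) < s := by exact_mod_cast hs
    have hn0 : (0 : ℝ) < n := by exact_mod_cast hn
    have hns' : (n : ℝ) ≤ 8 * s := by exact_mod_cast hns
    set y : ℝ := (n : ℝ) ^ (-α) + η
    have hy : 0 < y := by positivity
    have hσ : σ (2 * s) ≤ C₁ * (4 ^ α * y) := by
      refine (ih (2 * s) (by omega) (by omega)).trans ?_
      gcongr
      push_cast
      exact rpow_neg_add_le_rpow_mul hα.le hη.le (by norm_num) (by positivity) hn0
        (by linarith)
    have hd : d s ≤ C₀ * (8 ^ α * y) := by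
      refine (hb s hs).trans ?_
      gcongr
      exact rpow_neg_add_le_rpow_mul hα.le hη.le (by norm_num) hs0 hn0 hns'
    have hprod : σ (2 * s) * d s ≤ C₁ * (4 ^ α * y) * (C₀ * (8 ^ α * y)) :=
      mul_le_mul hσ hd (hd0 s) (by positivity)
    calc σ n ≤ σ (4 * s) := hmono _ _ hsn
      _ ≤ √2 * √(σ (2 * s) * d s) := ha s hs
      _ = √(2 * (σ (2 * s) * d s)) := (Real.sqrt_mul zero_le_two _).symm
      _ ≤ C₁ * y := by
        refine Real.sqrt_le_iff.mpr ⟨by positivity, ?_⟩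
        calc 2 * (σ (2 * s) * d s)
            ≤ 2 * (C₁ * (4 ^ α * y) * (C₀ * (8 ^ α * y))) := by gcongr
          _ = C₁ * (2 * (4 ^ α * 8 ^ α) * C₀) * y ^ 2 := by ring
          _ = (C₁ * y) ^ 2 := by rw [← hC]; ring
end
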